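/- For every L ≥ 0 there exist ε > 0 and a finite constant C, both depending only on L, with the following property. Let h_1, …, h_4 : ℝ → ℝ and L satisfy the deterministic form of Assumption 3.1, and let (X_1, …, X_4) be a centered jointly Gaussian random vector with E[X_j²] = 1 and ρ_{ij} = E[X_i X_j]. If M := max{ |ρ_{ij}| : i ≠ j } < ε, then |E[h_1(X_1) h_2(X_2) h_3(X_3) h_4(X_4)]| ≤ C M². -/

import Mathlib

open MeasureTheory ProbabilityTheory Filter

/-- A measure on `ℝ × ℝ` is a centered jointly Gaussian pair if every linear
combination of the coordinates has a centered Gaussian law. -/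
def JointlyGaussianPair (μ : Measure (ℝ × ℝ)) : Prop :=
  ∀ a b : ℝ, ∃ v : NNReal,
    Measure.map (fun p => a * p.1 + b * p.2) μ = gaussianReal 0 v

/-- The deterministic form of Assumption 3.1. -/
def Assumption31 {ι : Type*} (h : ι → ℝ → ℝ) (L : ℝ) : Prop :=
  (∀ j, ContDiff ℝ 1 (h j)) ∧
  (∀ j, (h j 0) ^ 2 ≤ L) ∧
  (∀ j, (deriv (h j) 0) ^ 2 ≤ L) ∧
  (∀ j, ∃ Lj : ℝ, Lj ^ 2 ≤ L ∧
    ∀ x y : ℝ, |deriv (h j) x - deriv (h j) y| ≤ Lj * |x - y|) ∧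
  (∀ j, ∫ x, h j x ∂(gaussianReal 0 1) = 0) ∧
  (∀ i j, i ≠ j → ∀ μ : Measure (ℝ × ℝ), IsProbabilityMeasure μ →
    JointlyGaussianPair μ → (∫ p, p.1 ^ 2 ∂μ) = 1 → (∫ p, p.2 ^ 2 ∂μ) = 1 →
    |∫ p, h i p.1 * h j p.2 ∂μ| ≤ L * |∫ p, p.1 * p.2 ∂μ|)

/-- A finite family of random variables is centered jointly Gaussian if every
linear combination of them has a centered Gaussian law. -/
def JointlyGaussianVec {Ω : Type*} [MeasurableSpace Ω] (P : Measure Ω)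
    {m : ℕ} (X : Fin m → Ω → ℝ) : Prop :=
  ∀ v : Fin m → ℝ, ∃ σ : NNReal,
    Measure.map (fun ω => ∑ i, v i * X i ω) P = gaussianReal 0 σ

namespace JointlyGaussianVec

variable {Ω : Type*} [MeasurableSpace Ω] {P : Measure Ω} {m : ℕ} {X : Fin m → Ω → ℝ}

lemma memLp_two (hX : ∀ i, Measurable (X i)) (hG : JointlyGaussianVec P X) (i : Fin m) :
    MemLp (X i) 2 P := by
  obtain ⟨σ, hσ⟩ := hG (Pi.single i 1)
  have hsum : (fun ω => ∑ k, (Pi.single i 1 : Fin m → ℝ) k * X k ω) = X i := by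
    ext ω
    simp [Pi.single_apply]
  rw [hsum] at hσ
  have hid : MemLp id 2 (Measure.map (X i) P) := hσ ▸ memLp_id_gaussianReal 2
  exact hid.comp_of_map (hX i).aemeasurable

lemma integral_sq_sum (hX : ∀ i, Measurable (X i)) (hG : JointlyGaussianVec P X)
    (t : Fin m → ℝ) :
    ∫ ω, (∑ i, t i * X i ω) ^ 2 ∂P =
      t ⬝ᵥ Matrix.mulVec (Matrix.of fun i j => ∫ ω, X i ω * X j ω ∂P) t := by
  have hint (i j : Fin m) : Integrable (fun ω => X i ω * X j ω) P :=
    (hG.memLp_two hX i).integrable_mul (hG.memLp_two hX j)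
  calc ∫ ω, (∑ i, t i * X i ω) ^ 2 ∂P
      = ∫ ω, ∑ i, ∑ j, t i * t j * (X i ω * X j ω) ∂P := by
        congr with ω
        rw [sq, Finset.sum_mul_sum]
        refine Finset.sum_congr rfl fun i _ => Finset.sum_congr rfl fun j _ => by ring
    _ = ∑ i, ∑ j, t i * t j * ∫ ω, X i ω * X j ω ∂P := by
        rw [integral_finsetSum _ fun i _ => integrable_finsetSum _ fun j _ =>
          (hint i j).const_mul _]
        refine Finset.sum_congr rfl fun i _ => ?_
        rw [integral_finsetSum _ fun j _ => (hint i j).const_mul _]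
        simp_rw [integral_const_mul]
    _ = _ := by
        simp only [dotProduct, Matrix.mulVec, Matrix.of_apply, Finset.mul_sum]
        refine Finset.sum_congr rfl fun i _ => Finset.sum_congr rfl fun j _ => by ring

lemma posSemidef_cov (hX : ∀ i, Measurable (X i)) (hG : JointlyGaussianVec P X) :
    (Matrix.of fun i j => ∫ ω, X i ω * X j ω ∂P).PosSemidef := by
  refine .of_dotProduct_mulVec_nonneg ?_ fun t => ?_
  · ext i j
    simp [mul_comm]
  · rw [star_trivial, ← hG.integral_sq_sum hX]
    exact integral_nonneg fun ω => sq_nonneg _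

/-- A centered jointly Gaussian vector is distributed according to the multivariate Gaussian
measure with the same covariance matrix. -/
lemma map_toLp_eq_multivariateGaussian [IsFiniteMeasure P] (hX : ∀ i, Measurable (X i))
    (hG : JointlyGaussianVec P X) :
    P.map (fun ω => WithLp.toLp 2 fun i => X i ω) =
      multivariateGaussian 0 (Matrix.of fun i j => ∫ ω, X i ω * X j ω ∂P) := by
  have hmeas : Measurable fun ω => WithLp.toLp 2 fun i => X i ω :=
    (WithLp.measurable_toLp 2 (Fin m → ℝ)).comp (measurable_pi_lambda _ hX)
  refine Measure.ext_of_charFun ?_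
  ext t
  obtain ⟨σ, hσ⟩ := hG t
  have hm : Measurable fun ω => ∑ i, t i * X i ω := by fun_prop
  have hvar : (σ : ℝ) = ∫ ω, (∑ i, t i * X i ω) ^ 2 ∂P := by
    have h1 := variance_id_gaussianReal (μ := 0) (v := σ)
    rw [variance_eq_integral (by fun_prop)] at h1
    simp only [id_eq, integral_id_gaussianReal, sub_zero] at h1
    rw [← h1, ← hσ, integral_map hm.aemeasurable (by fun_prop)]
  rw [charFun_multivariateGaussian (hG.posSemidef_cov hX), ← hG.integral_sq_sum hX t, ← hvar,
    charFun_apply, integral_map hmeas.aemeasurable (by fun_prop)]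
  have h2 := charFun_gaussianReal (μ := 0) (v := σ) 1
  rw [← hσ, charFun_apply_real, integral_map hm.aemeasurable (by fun_prop)] at h2
  simpa [PiLp.inner_apply] using h2

open scoped MatrixOrder in
/-- Expectations of a centered jointly Gaussian vector, written as integrals against independent
standard Gaussian variables. -/
lemma integral_comp_eq [IsFiniteMeasure P] (hX : ∀ i, Measurable (X i)) (hG : JointlyGaussianVec P X)
    {F : (Fin m → ℝ) → ℝ} (hF : Continuous F) :
    ∫ ω, F (fun i => X i ω) ∂P =
      ∫ g, F (Matrix.mulVec (CFC.sqrt (Matrix.of fun i j => ∫ ω, X i ω * X j ω ∂P)) g)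
        ∂(Measure.pi fun _ => gaussianReal 0 1) := by
  have hmeas : Measurable fun ω => WithLp.toLp 2 fun i => X i ω :=
    (WithLp.measurable_toLp 2 (Fin m → ℝ)).comp (measurable_pi_lambda _ hX)
  have hF' : Continuous fun x : EuclideanSpace ℝ (Fin m) => F x.ofLp := by fun_prop
  calc ∫ ω, F (fun i => X i ω) ∂P
      = ∫ x, F x.ofLp ∂(P.map fun ω => WithLp.toLp 2 fun i => X i ω) := by
        rw [integral_map hmeas.aemeasurable hF'.aestronglyMeasurable]
    _ = _ := by
        rw [hG.map_toLp_eq_multivariateGaussian hX, multivariateGaussian,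
          integral_map (by fun_prop) hF'.aestronglyMeasurable, ← map_pi_eq_stdGaussian,
          integral_map (by fun_prop) (by fun_prop)]
        simp

end JointlyGaussianVec

open scoped MatrixOrder in
/-- Passing to the square root does not increase the distance of a positive semidefinite matrix
to the identity, measured row by row. -/
lemma Matrix.PosSemidef.sum_sq_sqrt_sub_one_le {n : Type*} [Fintype n] [DecidableEq n]
    {A : Matrix n n ℝ} (hA : A.PosSemidef) (i : n) :
    ∑ j, (CFC.sqrt A - 1) i j ^ 2 ≤ ∑ j, (A - 1) i j ^ 2 := by
  set S := CFC.sqrt A with hS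
  have hSS : S * S = A := CFC.sqrt_mul_sqrt_self A hA.nonneg
  have hSpos : S.PosSemidef := Matrix.nonneg_iff_posSemidef.mp (CFC.sqrt_nonneg A)
  have row (B : Matrix n n ℝ) (hB : B.IsHermitian) : ∑ j, B i j ^ 2 = (B * B) i i := by
    rw [Matrix.mul_apply]
    refine Finset.sum_congr rfl fun j _ => ?_
    rw [sq, ← hB.apply i j]
    simp
  have hE : (S - 1).IsHermitian := hSpos.1.sub Matrix.isHermitian_one
  rw [row _ hE, row _ (hA.1.sub Matrix.isHermitian_one)]
  have hpos : ((S - 1) * (A + (2 : ℝ) • S) * (S - 1).conjTranspose).PosSemidef :=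
    (hA.add (hSpos.smul (by norm_num))).mul_mul_conjTranspose_same (S - 1)
  have hid : (A - 1) * (A - 1) =
      (S - 1) * (S - 1) + (S - 1) * (A + (2 : ℝ) • S) * (S - 1).conjTranspose := by
    rw [hE.eq, ← hSS, two_smul]
    noncomm_ring
  rw [hid, Matrix.add_apply]
  linarith [hpos.diag_nonneg (i := i)]

open scoped MatrixOrder in
lemma abs_sqrt_sub_one_apply_le {A : Matrix (Fin 4) (Fin 4) ℝ} {M : ℝ} (hA : A.PosSemidef)
    (hAM : ∀ i j, |(A - 1) i j| ≤ M) (i j : Fin 4) : |(CFC.sqrt A - 1) i j| ≤ 2 * M := by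
  have hM : 0 ≤ M := (abs_nonneg _).trans (hAM i j)
  refine abs_le_of_sq_le_sq ?_ (by positivity)
  calc (CFC.sqrt A - 1) i j ^ 2 ≤ ∑ k, (CFC.sqrt A - 1) i k ^ 2 :=
        Finset.single_le_sum (f := fun k => (CFC.sqrt A - 1) i k ^ 2)
          (fun k _ => sq_nonneg _) (Finset.mem_univ j)
    _ ≤ ∑ k, (A - 1) i k ^ 2 := hA.sum_sq_sqrt_sub_one_le i
    _ ≤ ∑ _k : Fin 4, M ^ 2 := Finset.sum_le_sum fun k _ => by
        rw [← sq_abs]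
        gcongr
        exact hAM i k
    _ = (2 * M) ^ 2 := by simp; ring

/-- First-order Taylor estimate for a function with Lipschitz derivative. -/
lemma abs_sub_sub_deriv_mul_le {f : ℝ → ℝ} {s : ℝ} (hf : Differentiable ℝ f)
    (hlip : ∀ x y, |deriv f x - deriv f y| ≤ s * |x - y|) (hs : 0 ≤ s) (x y : ℝ) :
    |f y - f x - deriv f x * (y - x)| ≤ s * (y - x) ^ 2 := by
  have hd (z : ℝ) : HasDerivAt (fun z => f z - deriv f x * z) (deriv f z - deriv f x) z := by
    simpa using (hf z).hasDerivAt.fun_sub ((hasDerivAt_id z).const_mul (deriv f x))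
  have key := (convex_uIcc x y).norm_image_sub_le_of_norm_hasDerivWithin_le
    (f := fun z => f z - deriv f x * z) (C := s * |y - x|)
    (fun z _ => (hd z).hasDerivWithinAt)
    (fun z hz => by
      rw [Real.norm_eq_abs]
      exact (hlip z x).trans
        (mul_le_mul_of_nonneg_left (Set.abs_sub_left_of_mem_uIcc hz) hs))
    Set.left_mem_uIcc Set.right_mem_uIcc
  rw [Real.norm_eq_abs, Real.norm_eq_abs, mul_assoc, ← sq, sq_abs] at key
  convert key using 2
  ring

lemma abs_deriv_le_of_lipschitz {f : ℝ → ℝ} {s : ℝ} (h0 : |deriv f 0| ≤ s)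
    (hlip : ∀ x y, |deriv f x - deriv f y| ≤ s * |x - y|) (x : ℝ) :
    |deriv f x| ≤ s * (1 + |x|) := by
  have h1 := hlip x 0
  rw [sub_zero] at h1
  have h2 := abs_sub_abs_le_abs_sub (deriv f x) (deriv f 0)
  linarith

lemma abs_le_of_lipschitz_deriv {f : ℝ → ℝ} {s : ℝ} (hf : Differentiable ℝ f) (h0 : |f 0| ≤ s)
    (h0' : |deriv f 0| ≤ s) (hlip : ∀ x y, |deriv f x - deriv f y| ≤ s * |x - y|) (x : ℝ) :
    |f x| ≤ s * (1 + |x|) ^ 2 := by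
  have hs : 0 ≤ s := (abs_nonneg _).trans h0
  have h1 := abs_sub_sub_deriv_mul_le hf hlip hs 0 x
  rw [sub_zero, ← sq_abs x] at h1
  have h2 : |deriv f 0 * x| ≤ s * |x| := by
    rw [abs_mul]
    gcongr
  have h3 : |f x| ≤ |f x - f 0 - deriv f 0 * x| + |f 0| + |deriv f 0 * x| := by
    calc |f x| = |f x - f 0 - deriv f 0 * x + f 0 + deriv f 0 * x| := by ring_nf
      _ ≤ _ := abs_add_three _ _ _
  nlinarith [mul_nonneg hs (abs_nonneg x)]

lemma integrable_one_add_abs_pow_gaussianReal (n : ℕ) (v : NNReal) :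
    Integrable (fun x : ℝ => (1 + |x|) ^ n) (gaussianReal 0 v) := by
  have h0 : MemLp (fun x : ℝ => |x|) n (gaussianReal 0 v) :=
    (memLp_id_gaussianReal' n (ENNReal.natCast_ne_top n)).norm
  have h1 : MemLp (fun x : ℝ => 1 + |x|) n (gaussianReal 0 v) :=
    MemLp.add (f := fun _ : ℝ => (1 : ℝ)) (memLp_const 1) h0
  have h2 := h1.integrable_norm_pow'
  simpa only [Real.norm_of_nonneg (add_nonneg zero_le_one (abs_nonneg _))] using h2

lemma integrable_gaussianReal_of_abs_le {f : ℝ → ℝ} (hf : Continuous f) {K : ℝ} {n : ℕ}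
    (hb : ∀ x, |f x| ≤ K * (1 + |x|) ^ n) (v : NNReal) : Integrable f (gaussianReal 0 v) :=
  ((integrable_one_add_abs_pow_gaussianReal n v).const_mul K).mono' hf.aestronglyMeasurable
    (.of_forall hb)

/-- Product rule for expansions to first order in a small parameter `M`. -/
lemma abs_mul_sub_first_order_le {a₁ b₁ r₁ a₂ b₂ r₂ A₁ B₁ R₁ A₂ B₂ R₂ M : ℝ}
    (hM : 0 ≤ M) (hM1 : M ≤ 1)
    (ha₁ : |a₁| ≤ A₁) (hb₁ : |b₁| ≤ B₁ * M) (hr₁ : |r₁| ≤ R₁ * M ^ 2)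
    (ha₂ : |a₂| ≤ A₂) (hb₂ : |b₂| ≤ B₂ * M) (hr₂ : |r₂| ≤ R₂ * M ^ 2)
    (hB₁ : 0 ≤ B₁) (hB₂ : 0 ≤ B₂) (hR₁ : 0 ≤ R₁) (hR₂ : 0 ≤ R₂) :
    |(a₁ + b₁ + r₁) * (a₂ + b₂ + r₂) - a₁ * a₂ - (a₁ * b₂ + b₁ * a₂)| ≤
      (A₁ * R₂ + R₁ * A₂ + B₁ * B₂ + B₁ * R₂ + R₁ * B₂ + R₁ * R₂) * M ^ 2 := by
  have hA₁ : 0 ≤ A₁ := (abs_nonneg _).trans ha₁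
  have hA₂ : 0 ≤ A₂ := (abs_nonneg _).trans ha₂
  have hM3 : M ^ 3 ≤ M ^ 2 := pow_le_pow_of_le_one hM hM1 (by norm_num)
  have hM4 : M ^ 4 ≤ M ^ 2 := pow_le_pow_of_le_one hM hM1 (by norm_num)
  have mul_le {x y p q : ℝ} (hx : |x| ≤ p) (hy : |y| ≤ q) : |x * y| ≤ p * q := by
    rw [abs_mul]
    exact mul_le_mul hx hy (abs_nonneg _) ((abs_nonneg _).trans hx)
  calc |(a₁ + b₁ + r₁) * (a₂ + b₂ + r₂) - a₁ * a₂ - (a₁ * b₂ + b₁ * a₂)|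
      = |a₁ * r₂ + r₁ * a₂ + b₁ * b₂ + b₁ * r₂ + r₁ * b₂ + r₁ * r₂| := by ring_nf
    _ ≤ |a₁ * r₂| + |r₁ * a₂| + |b₁ * b₂| + |b₁ * r₂| + |r₁ * b₂| + |r₁ * r₂| := by
        refine (abs_add_le _ _).trans (add_le_add_left ?_ _)
        refine (abs_add_le _ _).trans (add_le_add_left ?_ _)
        refine (abs_add_le _ _).trans (add_le_add_left ?_ _)
        exact abs_add_three _ _ _
    _ ≤ A₁ * (R₂ * M ^ 2) + R₁ * M ^ 2 * A₂ + B₁ * M * (B₂ * M) + B₁ * M * (R₂ * M ^ 2) +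
          R₁ * M ^ 2 * (B₂ * M) + R₁ * M ^ 2 * (R₂ * M ^ 2) := by
        gcongr <;> apply mul_le <;> assumption
    _ = (A₁ * R₂ + R₁ * A₂ + B₁ * B₂) * M ^ 2 + (B₁ * R₂ + R₁ * B₂) * M ^ 3 +
          R₁ * R₂ * M ^ 4 := by ring
    _ ≤ (A₁ * R₂ + R₁ * A₂ + B₁ * B₂) * M ^ 2 + (B₁ * R₂ + R₁ * B₂) * M ^ 2 +
          R₁ * R₂ * M ^ 2 := by gcongr
    _ = _ := by ring

/-- A product of four quantities, expanded to first order in a small parameter `M`. -/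
lemma abs_prod_four_sub_first_order_le {a b r : Fin 4 → ℝ} {M T : ℝ} (hM : 0 ≤ M) (hM1 : M ≤ 1)
    (ha : ∀ j, |a j| ≤ T) (hb : ∀ j, |b j| ≤ T * M) (hr : ∀ j, |r j| ≤ T * M ^ 2) :
    |∏ j, (a j + b j + r j) - ∏ j, a j - ∑ j, ∏ k, (if k = j then b k else a k)| ≤
      76 * T ^ 4 * M ^ 2 := by
  have hT : 0 ≤ T := (abs_nonneg _).trans (ha 0)
  have pair_zero (i j : Fin 4) : |a i * a j| ≤ T ^ 2 := by
    rw [abs_mul, sq]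
    exact mul_le_mul (ha i) (ha j) (abs_nonneg _) hT
  have pair_one (i j : Fin 4) : |a i * b j + b i * a j| ≤ 2 * T ^ 2 * M := by
    refine (abs_add_le _ _).trans ?_
    rw [abs_mul, abs_mul]
    calc |a i| * |b j| + |b i| * |a j| ≤ T * (T * M) + T * M * T := by
          gcongr <;> apply_assumption
      _ = _ := by ring
  have pair_two (i j : Fin 4) : |(a i + b i + r i) * (a j + b j + r j) - a i * a j -
      (a i * b j + b i * a j)| ≤ 6 * T ^ 2 * M ^ 2 :=
    (abs_mul_sub_first_order_le hM hM1 (ha i) (hb i) (hr i) (ha j) (hb j) (hr j)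
      hT hT hT hT).trans_eq (by ring)
  have key := abs_mul_sub_first_order_le hM hM1 (pair_zero 0 1) (pair_one 0 1) (pair_two 0 1)
    (pair_zero 2 3) (pair_one 2 3) (pair_two 2 3)
    (by positivity) (by positivity) (by positivity) (by positivity)
  refine le_trans (le_of_eq ?_) (key.trans_eq (by ring))
  congr 1
  simp [Fin.sum_univ_four, Fin.prod_univ_four]
  ring

/-- If one factor of a product of four mean-zero functions is replaced by a first-order increment
`h' k (g k) * ∑ i, E k i * g i`, the result is integrable with mean zero under independent standard
Gaussian variables. -/
lemma integrable_and_integral_prod_increment_eq_zero {h h' : Fin 4 → ℝ → ℝ} {s : ℝ}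
    (hc : ∀ j, Continuous (h j)) (hc' : ∀ j, Continuous (h' j))
    (hb : ∀ j x, |h j x| ≤ s * (1 + |x|) ^ 2) (hb' : ∀ j x, |h' j x| ≤ s * (1 + |x|))
    (hmean : ∀ j, ∫ x, h j x ∂(gaussianReal 0 1) = 0) (E : Matrix (Fin 4) (Fin 4) ℝ)
    (j : Fin 4) :
    Integrable (fun g : Fin 4 → ℝ =>
        ∏ k, (if k = j then h' k (g k) * ∑ i, E k i * g i else h k (g k)))
      (Measure.pi fun _ => gaussianReal 0 1) ∧
    ∫ g : Fin 4 → ℝ, ∏ k, (if k = j then h' k (g k) * ∑ i, E k i * g i else h k (g k))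
      ∂(Measure.pi fun _ => gaussianReal 0 1) = 0 := by
  have hs : 0 ≤ s := by simpa using (abs_nonneg _).trans (hb 0 0)
  let f (i k : Fin 4) (x : ℝ) : ℝ :=
    (if k = j then h' k x else h k x) * (if k = i then x else 1)
  have hf (i k : Fin 4) : Integrable (f i k) (gaussianReal 0 1) := by
    refine integrable_gaussianReal_of_abs_le (K := s) (n := 3) ?_ (fun x => ?_) 1
    · dsimp only [f]
      split_ifs <;> fun_prop
    · have h1 : |if k = j then h' k x else h k x| ≤ s * (1 + |x|) ^ 2 := by
        split_ifs
        · refine (hb' k x).trans ?_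
          gcongr
          exact le_self_pow₀ (by simp) two_ne_zero
        · exact hb k x
      have h2 : |if k = i then x else 1| ≤ 1 + |x| := by
        split_ifs <;> simp
      rw [abs_mul, pow_succ, ← mul_assoc]
      exact mul_le_mul h1 h2 (abs_nonneg _) (by positivity)
  have hexp (g : Fin 4 → ℝ) :
      ∏ k, (if k = j then h' k (g k) * ∑ i, E k i * g i else h k (g k)) =
        ∑ i, E j i * ∏ k, f i k (g k) := by
    have hi (i : Fin 4) :
        ∏ k, f i k (g k) = (∏ k, if k = j then h' k (g k) else h k (g k)) * g i := by
      rw [Finset.prod_mul_distrib]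
      simp
    have hl : ∏ k, (if k = j then h' k (g k) * ∑ i, E k i * g i else h k (g k)) =
        (∏ k, if k = j then h' k (g k) else h k (g k)) *
          ∏ k, (if k = j then ∑ i, E k i * g i else 1) := by
      rw [← Finset.prod_mul_distrib]
      refine Finset.prod_congr rfl fun k _ => ?_
      split_ifs <;> simp
    rw [hl, Finset.prod_ite_eq' _ j, if_pos (Finset.mem_univ j), Finset.mul_sum]
    simp_rw [hi]
    exact Finset.sum_congr rfl fun i _ => by ring
  have hint (i : Fin 4) : Integrable (fun g : Fin 4 → ℝ => E j i * ∏ k, f i k (g k))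
      (Measure.pi fun _ => gaussianReal 0 1) := (Integrable.fintype_prod (hf i)).const_mul _
  simp_rw [hexp]
  refine ⟨integrable_finsetSum _ fun i _ => hint i, ?_⟩
  rw [integral_finsetSum _ fun i _ => hint i]
  refine Finset.sum_eq_zero fun i _ => ?_
  obtain ⟨k, hkj, hki⟩ : ∃ k : Fin 4, k ≠ j ∧ k ≠ i := by
    clear * -
    revert i j
    decide
  rw [integral_const_mul, integral_fintype_prod_eq_prod (𝕜 := ℝ) (f i),
    Finset.prod_eq_zero (Finset.mem_univ k), mul_zero]
  simp [f, hkj, hki, hmean]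

/-- If `B` is at entrywise distance at most `2 * M` from the identity, the expectation of
`∏ j, h j ((B *ᵥ g) j)` for a standard Gaussian vector `g` is of order `M ^ 2`. -/
lemma abs_integral_prod_mulVec_le {h : Fin 4 → ℝ → ℝ} {s : ℝ}
    (hd : ∀ j, ContDiff ℝ 1 (h j)) (h0 : ∀ j, |h j 0| ≤ s) (h0' : ∀ j, |deriv (h j) 0| ≤ s)
    (hlip : ∀ j x y, |deriv (h j) x - deriv (h j) y| ≤ s * |x - y|)
    (hmean : ∀ j, ∫ x, h j x ∂(gaussianReal 0 1) = 0)
    {B : Matrix (Fin 4) (Fin 4) ℝ} {M : ℝ} (hM : 0 ≤ M) (hM1 : M ≤ 1)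
    (hB : ∀ i j, |(B - 1) i j| ≤ 2 * M) :
    |∫ g, ∏ j, h j (B.mulVec g j) ∂(Measure.pi fun _ => gaussianReal 0 1)| ≤
      76 * (64 * s) ^ 4 *
        (∫ g : Fin 4 → ℝ, ∏ j, (1 + |g j|) ^ 8 ∂(Measure.pi fun _ => gaussianReal 0 1)) *
        M ^ 2 := by
  have hs : 0 ≤ s := (abs_nonneg _).trans (h0 0)
  have hdiff (j : Fin 4) : Differentiable ℝ (h j) := (hd j).differentiable one_ne_zero
  have hc (j : Fin 4) : Continuous (h j) := (hd j).continuous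
  have hc' (j : Fin 4) : Continuous (deriv (h j)) := (hd j).continuous_deriv le_rfl
  have hb (j : Fin 4) (x : ℝ) := abs_le_of_lipschitz_deriv (hdiff j) (h0 j) (h0' j) (hlip j) x
  have hb' (j : Fin 4) (x : ℝ) := abs_deriv_le_of_lipschitz (h0' j) (hlip j) x
  set μ : Measure (Fin 4 → ℝ) := Measure.pi fun _ => gaussianReal 0 1 with hμ
  let d (g : Fin 4 → ℝ) (j : Fin 4) : ℝ := ∑ i, (B - 1) j i * g i
  let Z (g : Fin 4 → ℝ) : ℝ := ∏ j, h j (g j)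
  let D (j : Fin 4) (g : Fin 4 → ℝ) : ℝ :=
    ∏ k, (if k = j then deriv (h k) (g k) * d g k else h k (g k))
  let R (g : Fin 4 → ℝ) : ℝ := ∏ j, h j (B.mulVec g j) - Z g - ∑ j, D j g
  have hBd (g : Fin 4 → ℝ) (j : Fin 4) : B.mulVec g j - g j = d g j := by
    have : (B - 1).mulVec g j = B.mulVec g j - g j := by
      rw [Matrix.sub_mulVec, Matrix.one_mulVec, Pi.sub_apply]
    rw [← this]
    rfl
  have hZint : Integrable Z μ := Integrable.fintype_prod fun j =>
    integrable_gaussianReal_of_abs_le (hc j) (hb j) 1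
  have hZ : ∫ g, Z g ∂μ = 0 := by
    rw [hμ, integral_fintype_prod_eq_prod (𝕜 := ℝ) h]
    simp [hmean]
  have hD (j : Fin 4) : Integrable (D j) μ ∧ ∫ g, D j g ∂μ = 0 :=
    integrable_and_integral_prod_increment_eq_zero hc hc' hb hb' hmean (B - 1) j
  have hbound (g : Fin 4 → ℝ) : |R g| ≤ 76 * (64 * s) ^ 4 * M ^ 2 * ∏ j, (1 + |g j|) ^ 8 := by
    set N := ∏ j, (1 + |g j|) with hN
    have hNj (j : Fin 4) : 1 + |g j| ≤ N := by
      rw [hN, ← Finset.mul_prod_erase _ _ (Finset.mem_univ j)]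
      refine le_mul_of_one_le_right (by positivity) ?_
      simpa using Finset.prod_le_prod (s := Finset.univ.erase j) (f := fun _ => (1 : ℝ))
        (g := fun k => 1 + |g k|) (by simp) (by simp)
    have hN1 : 1 ≤ N := (by simp : (1 : ℝ) ≤ 1 + |g 0|).trans (hNj 0)
    have hdj (j : Fin 4) : |d g j| ≤ 8 * M * N := by
      calc |d g j| ≤ ∑ i, |(B - 1) j i * g i| := Finset.abs_sum_le_sum_abs _ _
        _ ≤ ∑ _i : Fin 4, 2 * M * N := by
            refine Finset.sum_le_sum fun i _ => ?_
            rw [abs_mul]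
            exact mul_le_mul (hB j i) (by linarith [hNj i]) (abs_nonneg _) (by positivity)
        _ = 8 * M * N := by simp; ring
    have key := abs_prod_four_sub_first_order_le (a := fun j => h j (g j))
      (b := fun j => deriv (h j) (g j) * d g j)
      (r := fun j => h j (B.mulVec g j) - h j (g j) - deriv (h j) (g j) * d g j)
      (T := 64 * s * N ^ 2) hM hM1
      (fun j => by
        have h1 : s * (1 + |g j|) ^ 2 ≤ s * N ^ 2 := by gcongr; exact hNj j
        have h2 : 0 ≤ s * N ^ 2 := by positivity
        linarith [hb j (g j)])
      (fun j => by
        have h1 : |deriv (h j) (g j)| * |d g j| ≤ s * N * (8 * M * N) := by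
          refine mul_le_mul ((hb' j (g j)).trans ?_) (hdj j) (abs_nonneg _) (by positivity)
          gcongr
          exact hNj j
        have h2 : 0 ≤ s * N ^ 2 * M := by positivity
        rw [abs_mul]
        linarith)
      (fun j => by
        have h1 := abs_sub_sub_deriv_mul_le (hdiff j) (hlip j) hs (g j) (B.mulVec g j)
        rw [hBd] at h1
        have h2 : s * d g j ^ 2 ≤ s * (8 * M * N) ^ 2 := by
          rw [← sq_abs (d g j)]
          gcongr
          exact hdj j
        linarith)
    calc |R g| ≤ 76 * (64 * s * N ^ 2) ^ 4 * M ^ 2 := by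
          refine le_of_eq_of_le ?_ key
          simp [R, D, Z]
      _ = _ := by rw [Finset.prod_pow, ← hN]; ring
  have hNint : Integrable (fun g : Fin 4 → ℝ => ∏ j, (1 + |g j|) ^ 8) μ :=
    Integrable.fintype_prod fun _ => integrable_one_add_abs_pow_gaussianReal 8 1
  have hRc : Continuous R := by
    have hmul (j : Fin 4) : Continuous fun g : Fin 4 → ℝ => B.mulVec g j := by
      dsimp only [Matrix.mulVec, dotProduct]
      fun_prop
    refine ((continuous_finsetProd _ fun j _ => (hc j).comp (hmul j)).sub (by fun_prop)).sub
      (continuous_finsetSum _ fun j _ => continuous_finsetProd _ fun k _ => ?_)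
    split_ifs <;> fun_prop
  have hRint : Integrable R μ :=
    (hNint.const_mul _).mono' hRc.aestronglyMeasurable (.of_forall hbound)
  have hsum : ∫ g, ∏ j, h j (B.mulVec g j) ∂μ = ∫ g, R g ∂μ := by
    have hDint : Integrable (fun g => ∑ j, D j g) μ := integrable_finsetSum _ fun j _ => (hD j).1
    calc ∫ g, ∏ j, h j (B.mulVec g j) ∂μ = ∫ g, (R g + Z g + ∑ j, D j g) ∂μ := by
          congr with g
          simp only [R]
          ring
      _ = ∫ g, R g ∂μ + ∫ g, Z g ∂μ + ∑ j, ∫ g, D j g ∂μ := by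
          have hRZ : Integrable (fun g => R g + Z g) μ := hRint.add hZint
          rw [integral_add hRZ hDint, integral_add hRint hZint,
            integral_finsetSum _ fun j _ => (hD j).1]
      _ = ∫ g, R g ∂μ := by simp [hZ, hD]
  rw [hsum]
  calc |∫ g, R g ∂μ|
      ≤ ∫ g, 76 * (64 * s) ^ 4 * M ^ 2 * ∏ j, (1 + |g j|) ^ 8 ∂μ := by
        rw [← Real.norm_eq_abs]
        exact norm_integral_le_of_norm_le (hNint.const_mul _) (.of_forall hbound)
    _ = _ := by
        rw [integral_const_mul]
        ring

/-- Lemma 3.3, inequality (3.8): for every `L ≥ 0` there are `ε > 0` and a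
constant `C`, depending only on `L`, such that `|E[∏ h_j(X_j)]| ≤ CM²` whenever
`M = max_{i ≠ j} |ρ_{ij}| < ε`. -/
theorem product_bound_small_correlations (L : ℝ) (hL : 0 ≤ L) :
    ∃ ε > (0 : ℝ), ∃ C : ℝ, ∀ (h : Fin 4 → ℝ → ℝ), Assumption31 h L →
      ∀ (Ω : Type) [MeasurableSpace Ω] (P : Measure Ω), IsProbabilityMeasure P →
      ∀ X : Fin 4 → Ω → ℝ, (∀ i, Measurable (X i)) →
      JointlyGaussianVec P X →
      ∀ ρ : Fin 4 → Fin 4 → ℝ,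
      (∀ i j, ρ i j = ∫ ω, X i ω * X j ω ∂P) →
      (∀ i, ρ i i = 1) →
      ∀ M : ℝ,
      M = max (max (max |ρ 0 1| |ρ 0 2|) (max |ρ 0 3| |ρ 1 2|)) (max |ρ 1 3| |ρ 2 3|) →
      M < ε →
      |∫ ω, h 0 (X 0 ω) * h 1 (X 1 ω) * h 2 (X 2 ω) * h 3 (X 3 ω) ∂P| ≤
        C * M ^ 2 := by
  refine ⟨1, one_pos, 76 * (64 * √L) ^ 4 *
    ∫ g : Fin 4 → ℝ, ∏ j, (1 + |g j|) ^ 8 ∂(Measure.pi fun _ => gaussianReal 0 1), ?_⟩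
  intro h hh Ω _ P _ X hX hG ρ hρ hρ1 M hM hM1
  obtain ⟨hd, h0, h0', hlip, hmean, -⟩ := hh
  have hρs (i j : Fin 4) : ρ i j = ρ j i := by simp_rw [hρ, mul_comm]
  have hMρ (i j : Fin 4) (hij : i ≠ j) : |ρ i j| ≤ M := by
    have hlt (i j : Fin 4) (hij : i < j) : |ρ i j| ≤ M := by
      rw [hM]
      clear * - hij
      fin_cases i <;> fin_cases j <;> simp_all
    rcases hij.lt_or_gt with hij | hij
    · exact hlt i j hij
    · exact hρs i j ▸ hlt j i hij
  have hM0 : 0 ≤ M := (abs_nonneg _).trans (hMρ 0 1 (by decide))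
  set A : Matrix (Fin 4) (Fin 4) ℝ := Matrix.of fun i j => ∫ ω, X i ω * X j ω ∂P with hA
  have hAρ (i j : Fin 4) : |(A - 1) i j| ≤ M := by
    rw [Matrix.sub_apply, hA, Matrix.of_apply, ← hρ]
    by_cases hij : i = j
    · subst hij
      simp [hρ1, hM0]
    · simpa [Matrix.one_apply_ne hij] using hMρ i j hij
  have hc (j : Fin 4) : Continuous (h j) := (hd j).continuous
  have hlaw := hG.integral_comp_eq hX (F := fun x => ∏ j, h j (x j)) (by fun_prop)
  simp only [Fin.prod_univ_four (fun j => h j (X j _))] at hlaw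
  rw [hlaw]
  refine abs_integral_prod_mulVec_le hd (fun j => Real.abs_le_sqrt (h0 j))
    (fun j => Real.abs_le_sqrt (h0' j)) (fun j x y => ?_) hmean hM0 hM1.le
    (abs_sqrt_sub_one_apply_le (hG.posSemidef_cov hX) hAρ)
  obtain ⟨Lj, hLj, hlj⟩ := hlip j
  exact (hlj x y).trans (mul_le_mul_of_nonneg_right (Real.le_sqrt_of_sq_le hLj) (abs_nonneg _))
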